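/- Let N ≥ 2, T > 0, ξ : [0,T] → ℝ^N continuous, and F(x,t) = ∫₀^t Φ(x-ξ(s), t-s) ds with Φ the heat kernel. Then F is a classical solution of the heat equation F_t = ΔF on the open set D = {(x,t) ∈ ℝ^N × (0,T) : x ≠ ξ(t)}. -/

import Mathlib

open MeasureTheory Real Set Metric

noncomputable section

/-- The heat kernel on ℝ^N. -/
def heatKernel (N : ℕ) (x : EuclideanSpace ℝ (Fin N)) (t : ℝ) : ℝ :=
  (4 * π * t) ^ (-(N : ℝ) / 2) * Real.exp (-‖x‖ ^ 2 / (4 * t))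

/-- The time-integrated heat kernel along the curve ξ. -/
def Fsol (N : ℕ) (ξ : ℝ → EuclideanSpace ℝ (Fin N))
    (x : EuclideanSpace ℝ (Fin N)) (t : ℝ) : ℝ :=
  ∫ s in (0 : ℝ)..t, heatKernel N (x - ξ s) (t - s)

/-- `u` is a classical solution of the heat equation `u_t = Δu` on the set `S`. -/
def IsHeatSolution {N : ℕ} (u : EuclideanSpace ℝ (Fin N) → ℝ → ℝ)
    (S : Set (EuclideanSpace ℝ (Fin N) × ℝ)) : Prop :=
  ContinuousOn (fun p => u p.1 p.2) S ∧
  ∀ p ∈ S, ContDiffAt ℝ 2 (fun x => u x p.2) p.1 ∧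
    HasDerivAt (fun τ => u p.1 τ)
      (∑ i, iteratedDeriv 2
        (fun h : ℝ => u (p.1 + h • EuclideanSpace.single i (1 : ℝ)) p.2) 0) p.2

open Filter Topology

universe u

/-- The function equal to `u ^ a * exp (-1 / u)` for `u > 0` and to `0` for `u ≤ 0`. -/
def rpowExpNegInv (a u : ℝ) : ℝ := if 0 < u then u ^ a * Real.exp (-u⁻¹) else 0

lemma rpowExpNegInv_of_pos (a : ℝ) {u : ℝ} (hu : 0 < u) :
    rpowExpNegInv a u = u ^ a * Real.exp (-u⁻¹) := if_pos hu

lemma rpowExpNegInv_of_nonpos (a : ℝ) {u : ℝ} (hu : u ≤ 0) : rpowExpNegInv a u = 0 :=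
  if_neg hu.not_gt

lemma tendsto_rpowExpNegInv_zero (a : ℝ) : Tendsto (rpowExpNegInv a) (𝓝 0) (𝓝 0) := by
  suffices h : Tendsto (rpowExpNegInv a) (𝓝[≤] 0 ⊔ 𝓝[>] 0) (𝓝 0) by
    rwa [nhdsLE_sup_nhdsGT] at h
  rw [tendsto_sup]
  constructor
  · refine tendsto_const_nhds.congr' ?_
    filter_upwards [self_mem_nhdsWithin] with u hu using (rpowExpNegInv_of_nonpos a hu).symm
  · have h := (tendsto_rpow_mul_exp_neg_mul_atTop_nhds_zero (-a) 1 one_pos).comp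
      (tendsto_inv_nhdsGT_zero (𝕜 := ℝ))
    refine h.congr' ?_
    filter_upwards [self_mem_nhdsWithin] with u (hu : 0 < u)
    rw [rpowExpNegInv_of_pos a hu, Function.comp_apply, Real.inv_rpow hu.le, Real.rpow_neg hu.le,
      inv_inv, neg_one_mul]

lemma hasDerivAt_rpowExpNegInv (a u : ℝ) :
    HasDerivAt (rpowExpNegInv a)
      (a * rpowExpNegInv (a - 1) u + rpowExpNegInv (a - 2) u) u := by
  rcases lt_trichotomy u 0 with hu | rfl | hu
  · rw [rpowExpNegInv_of_nonpos _ hu.le, rpowExpNegInv_of_nonpos _ hu.le, mul_zero, add_zero]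
    refine (hasDerivAt_const u (0 : ℝ)).congr_of_eventuallyEq ?_
    filter_upwards [Iio_mem_nhds hu] with v (hv : v < 0) using rpowExpNegInv_of_nonpos a hv.le
  · rw [rpowExpNegInv_of_nonpos _ le_rfl, rpowExpNegInv_of_nonpos _ le_rfl, mul_zero, add_zero,
      hasDerivAt_iff_tendsto_slope]
    refine ((tendsto_rpowExpNegInv_zero (a - 1)).mono_left nhdsWithin_le_nhds).congr fun v => ?_
    rw [slope_def_field, rpowExpNegInv_of_nonpos a le_rfl, sub_zero, sub_zero]
    rcases le_or_gt v 0 with hv | hv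
    · simp [rpowExpNegInv_of_nonpos _ hv]
    · rw [rpowExpNegInv_of_pos _ hv, rpowExpNegInv_of_pos _ hv, Real.rpow_sub_one hv.ne']
      ring
  · have h := (Real.hasDerivAt_rpow_const (x := u) (p := a) (Or.inl hu.ne')).mul
      (hasDerivAt_inv hu.ne').neg.exp
    have h' : HasDerivAt (rpowExpNegInv a) _ u := h.congr_of_eventuallyEq <| by
      filter_upwards [Ioi_mem_nhds hu] with v hv using rpowExpNegInv_of_pos a hv
    convert h' using 1
    rw [rpowExpNegInv_of_pos _ hu, rpowExpNegInv_of_pos _ hu, Real.rpow_sub hu a 2]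
    simp only [Pi.neg_apply, Real.rpow_two]
    ring

lemma contDiff_rpowExpNegInv (n : ℕ) (a : ℝ) : ContDiff ℝ n (rpowExpNegInv a) := by
  induction n generalizing a with
  | zero =>
    exact contDiff_zero.2 (continuous_iff_continuousAt.2 fun u =>
      (hasDerivAt_rpowExpNegInv a u).continuousAt)
  | succ n ih =>
    rw [Nat.cast_succ, contDiff_succ_iff_deriv]
    refine ⟨fun u => (hasDerivAt_rpowExpNegInv a u).differentiableAt, by simp, ?_⟩
    rw [funext fun u => (hasDerivAt_rpowExpNegInv a u).deriv]
    exact (contDiff_const.mul (ih _)).add (ih _)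

/-- The heat kernel extended by zero to nonpositive times, as a function on space-time. -/
def heatKernelExt (N : ℕ) (q : EuclideanSpace ℝ (Fin N) × ℝ) : ℝ :=
  if 0 < q.2 then heatKernel N q.1 q.2 else 0

lemma heatKernelExt_of_pos {N : ℕ} {q : EuclideanSpace ℝ (Fin N) × ℝ} (hq : 0 < q.2) :
    heatKernelExt N q = heatKernel N q.1 q.2 := if_pos hq

lemma heatKernelExt_of_nonpos {N : ℕ} {q : EuclideanSpace ℝ (Fin N) × ℝ} (hq : q.2 ≤ 0) :
    heatKernelExt N q = 0 := if_neg hq.not_gt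

lemma heatKernelExt_nonneg {N : ℕ} (q : EuclideanSpace ℝ (Fin N) × ℝ) :
    0 ≤ heatKernelExt N q := by
  unfold heatKernelExt heatKernel
  split_ifs with h
  · positivity
  · exact le_rfl

lemma heatKernelExt_eq_rpowExpNegInv {N : ℕ} {q : EuclideanSpace ℝ (Fin N) × ℝ} (hq : q.1 ≠ 0) :
    heatKernelExt N q = (π * ‖q.1‖ ^ 2) ^ (-(N : ℝ) / 2) *
      rpowExpNegInv (-(N : ℝ) / 2) (4 * q.2 / ‖q.1‖ ^ 2) := by
  have hx : 0 < ‖q.1‖ := norm_pos_iff.2 hq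
  rcases le_or_gt q.2 0 with h | h
  · rw [heatKernelExt_of_nonpos h, rpowExpNegInv_of_nonpos, mul_zero]
    exact div_nonpos_of_nonpos_of_nonneg (by linarith) (by positivity)
  · rw [heatKernelExt_of_pos h, rpowExpNegInv_of_pos _ (by positivity), ← mul_assoc,
      ← Real.mul_rpow (by positivity) (by positivity), heatKernel]
    congr 2
    · field_simp
    · field_simp

lemma contDiffAt_heatKernelExt {N : ℕ} (n : ℕ) {q : EuclideanSpace ℝ (Fin N) × ℝ} (hq : q ≠ 0) :
    ContDiffAt ℝ n (heatKernelExt N) q := by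
  rcases lt_trichotomy q.2 0 with h | h | h
  · refine (contDiffAt_const (c := (0 : ℝ))).congr_of_eventuallyEq ?_
    filter_upwards [continuous_snd.continuousAt.eventually_lt continuousAt_const h] with p hp
      using heatKernelExt_of_nonpos hp.le
  · have hx : q.1 ≠ 0 := fun hx => hq (Prod.ext hx h)
    have hn : ContDiffAt ℝ n (fun p : EuclideanSpace ℝ (Fin N) × ℝ => ‖p.1‖ ^ 2) q :=
      (contDiff_fst.norm_sq ℝ).contDiffAt
    have hne : ‖q.1‖ ^ 2 ≠ 0 := by positivity
    refine ContDiffAt.congr_of_eventuallyEq (f := fun p : EuclideanSpace ℝ (Fin N) × ℝ =>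
      (π * ‖p.1‖ ^ 2) ^ (-(N : ℝ) / 2) *
      rpowExpNegInv (-(N : ℝ) / 2) (4 * p.2 / ‖p.1‖ ^ 2)) ?_ ?_
    · refine ((contDiffAt_const.mul hn).rpow_const_of_ne ?_).mul
        ((contDiff_rpowExpNegInv n _).contDiffAt.comp q
          ((contDiffAt_const.mul contDiffAt_snd).div hn hne))
      exact mul_ne_zero pi_ne_zero hne
    · filter_upwards [continuous_fst.continuousAt.eventually_ne hx] with p hp
        using heatKernelExt_eq_rpowExpNegInv hp
  · refine ContDiffAt.congr_of_eventuallyEq (f := fun p : EuclideanSpace ℝ (Fin N) × ℝ =>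
      (4 * π * p.2) ^ (-(N : ℝ) / 2) * Real.exp (-‖p.1‖ ^ 2 / (4 * p.2))) ?_ ?_
    · refine ((contDiffAt_const.mul contDiffAt_snd).rpow_const_of_ne (by positivity)).mul
        (((contDiff_fst.norm_sq ℝ).contDiffAt.neg.div
          (contDiffAt_const.mul contDiffAt_snd) (by positivity)).exp)
    · filter_upwards [continuousAt_const.eventually_lt continuous_snd.continuousAt h] with p hp
        using heatKernelExt_of_pos hp

lemma hasFDerivAt_intervalIntegral_comp_sub {E G : Type*} [NormedAddCommGroup E]
    [NormedSpace ℝ E] [ProperSpace E] [NormedAddCommGroup G] [NormedSpace ℝ G]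
    {k : E → G} (hk : ContDiffOn ℝ 1 k {0}ᶜ) {γ : ℝ → E} (hγ : Continuous γ) {a b : ℝ} {p : E}
    (hp : p ∉ γ '' uIcc a b) :
    HasFDerivAt (fun q => ∫ s in a..b, k (q - γ s)) (∫ s in a..b, fderiv ℝ k (p - γ s)) p := by
  have hcl : IsClosed (γ '' uIcc a b) := (isCompact_uIcc.image hγ).isClosed
  obtain ⟨r, hr, hball⟩ := Metric.nhds_basis_closedBall.mem_iff.1 (hcl.isOpen_compl.mem_nhds hp)
  have hne : ∀ q ∈ closedBall p r, ∀ s ∈ uIcc a b, q - γ s ∈ ({0}ᶜ : Set E) :=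
    fun q hq s hs h => hball hq ⟨s, hs, (sub_eq_zero.1 h).symm⟩
  have hopen : IsOpen ({0}ᶜ : Set E) := isOpen_compl_singleton
  have hk' : ContinuousOn (fderiv ℝ k) {0}ᶜ := hk.continuousOn_fderiv_of_isOpen hopen le_rfl
  have hcont : ∀ q ∈ closedBall p r, ContinuousOn (fun s => k (q - γ s)) (uIcc a b) :=
    fun q hq => hk.continuousOn.comp (by fun_prop) (hne q hq)
  have hcont' : ContinuousOn (fun s => fderiv ℝ k (p - γ s)) (uIcc a b) :=
    hk'.comp (by fun_prop) (hne p (mem_closedBall_self hr.le))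
  obtain ⟨C, hC⟩ := ((isCompact_closedBall p r).prod
    (isCompact_uIcc (a := a) (b := b))).exists_bound_of_continuousOn
    (f := fun z : E × ℝ => fderiv ℝ k (z.1 - γ z.2))
    (hk'.comp (by fun_prop) fun z hz => hne z.1 hz.1 z.2 hz.2)
  refine intervalIntegral.hasFDerivAt_integral_of_dominated_of_fderiv_le
    (F' := fun q s => fderiv ℝ k (q - γ s)) (bound := fun _ => C)
    (closedBall_mem_nhds p hr) ?_ (hcont p (mem_closedBall_self hr.le)).intervalIntegrable ?_ ?_
    intervalIntegrable_const ?_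
  · filter_upwards [closedBall_mem_nhds p hr] with q hq
    exact ((hcont q hq).mono uIoc_subset_uIcc).aestronglyMeasurable measurableSet_uIoc
  · exact (hcont'.mono uIoc_subset_uIcc).aestronglyMeasurable measurableSet_uIoc
  · exact Eventually.of_forall fun s hs q hq => hC (q, s) ⟨hq, uIoc_subset_uIcc hs⟩
  · refine Eventually.of_forall fun s hs q hq => ?_
    have h := ((hk.differentiableOn one_ne_zero).differentiableAt
      (hopen.mem_nhds (hne q hq s (uIoc_subset_uIcc hs)))).hasFDerivAt
    simpa [Function.comp_def] using h.comp q ((hasFDerivAt_id q).sub_const (γ s))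

lemma contDiffOn_intervalIntegral_comp_sub {E G : Type u} [NormedAddCommGroup E]
    [NormedSpace ℝ E] [ProperSpace E] [NormedAddCommGroup G] [NormedSpace ℝ G] (n : ℕ)
    {k : E → G} (hk : ContDiffOn ℝ (n + 1) k {0}ᶜ) {γ : ℝ → E} (hγ : Continuous γ) (a b : ℝ) :
    ContDiffOn ℝ n (fun q => ∫ s in a..b, k (q - γ s)) (γ '' uIcc a b)ᶜ := by
  have hopen : IsOpen (γ '' uIcc a b)ᶜ := (isCompact_uIcc.image hγ).isClosed.isOpen_compl
  induction n generalizing G with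
  | zero =>
    refine contDiffOn_zero.2 fun q hq => ?_
    exact (hasFDerivAt_intervalIntegral_comp_sub (by simpa using hk) hγ
      hq).continuousAt.continuousWithinAt
  | succ n ih =>
    have hd : ∀ q ∈ (γ '' uIcc a b)ᶜ, HasFDerivAt (fun q => ∫ s in a..b, k (q - γ s))
        (∫ s in a..b, fderiv ℝ k (q - γ s)) q := fun q hq =>
      hasFDerivAt_intervalIntegral_comp_sub (hk.of_le (by simp)) hγ hq
    rw [Nat.cast_succ, contDiffOn_succ_iff_fderiv_of_isOpen hopen]
    refine ⟨fun q hq => (hd q hq).differentiableAt.differentiableWithinAt, by simp, ?_⟩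
    refine (ih (k := fderiv ℝ k) (hk.fderiv_of_isOpen isOpen_compl_singleton ?_)).congr
      fun q hq => (hd q hq).fderiv
    simp

lemma iteratedDeriv_two_comp_line {E : Type*} [NormedAddCommGroup E] [NormedSpace ℝ E]
    {u : E → ℝ} {p : E} (hu : ContDiffAt ℝ 2 u p) (v : E) :
    iteratedDeriv 2 (fun h : ℝ => u (p + h • v)) 0 = fderiv ℝ (fun q => fderiv ℝ u q v) p v := by
  have hline : ∀ h : ℝ, HasDerivAt (fun h : ℝ => p + h • v) v h := fun h => by
    simpa using ((hasDerivAt_id h).smul_const v).const_add p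
  have hev : ∀ᶠ q in 𝓝 p, DifferentiableAt ℝ u q := by
    filter_upwards [hu.eventually (by simp)] with q hq using hq.differentiableAt two_ne_zero
  have ht : Tendsto (fun h : ℝ => p + h • v) (𝓝 0) (𝓝 p) := by
    simpa [ContinuousAt] using (hline 0).continuousAt
  rw [iteratedDeriv_succ, iteratedDeriv_one]
  have heq : deriv (fun h : ℝ => u (p + h • v)) =ᶠ[𝓝 0] fun h => fderiv ℝ u (p + h • v) v := by
    filter_upwards [ht.eventually hev] with h hh
    exact (hh.hasFDerivAt.comp_hasDerivAt h (hline h)).deriv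
  rw [heq.deriv_eq]
  have hd : DifferentiableAt ℝ (fun q => fderiv ℝ u q v) (p + (0 : ℝ) • v) := by
    rw [zero_smul, add_zero]
    exact ((hu.fderiv_right (m := 1) (by norm_num)).differentiableAt one_ne_zero).clm_apply
      (differentiableAt_const v)
  have := (hd.hasFDerivAt.comp_hasDerivAt (0 : ℝ) (hline 0)).deriv
  simpa [Function.comp_def] using this

lemma contDiffOn_heatKernelExt (N n : ℕ) : ContDiffOn ℝ n (heatKernelExt N) {0}ᶜ :=
  fun _ hq => (contDiffAt_heatKernelExt n hq).contDiffWithinAt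

lemma iteratedDeriv_two_exp_neg_sq (A B c τ : ℝ) (hτ : τ ≠ 0) :
    iteratedDeriv 2 (fun h : ℝ => A * Real.exp (-(B + 2 * c * h + h ^ 2) / (4 * τ))) 0 =
      A * Real.exp (-B / (4 * τ)) * (c ^ 2 / (4 * τ ^ 2) - 1 / (2 * τ)) := by
  have h1 : ∀ h : ℝ, HasDerivAt (fun h : ℝ => A * Real.exp (-(B + 2 * c * h + h ^ 2) / (4 * τ)))
      (A * Real.exp (-(B + 2 * c * h + h ^ 2) / (4 * τ)) * (-(c + h) / (2 * τ))) h := fun h => by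
    have := ((((((hasDerivAt_id h).const_mul (2 * c)).const_add B).add
      ((hasDerivAt_id h).pow 2)).neg.div_const (4 * τ)).exp).const_mul A
    refine this.congr_deriv ?_
    simp
    field_simp
    ring
  rw [iteratedDeriv_succ, iteratedDeriv_one, funext fun h => (h1 h).deriv]
  have h2 := ((h1 0).mul (((hasDerivAt_id (0 : ℝ)).const_add c).neg.div_const (2 * τ))).deriv
  refine Eq.trans h2 ?_
  simp
  field_simp
  ring

lemma hasDerivAt_heatKernel {N : ℕ} (x : EuclideanSpace ℝ (Fin N)) {t : ℝ} (ht : 0 < t) :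
    HasDerivAt (heatKernel N x)
      (heatKernel N x t * (‖x‖ ^ 2 / (4 * t ^ 2) - N / (2 * t))) t := by
  have h1 : HasDerivAt (fun t : ℝ => 4 * π * t) (4 * π) t := by
    simpa using (hasDerivAt_id t).const_mul (4 * π)
  have h2 : HasDerivAt (fun t : ℝ => -‖x‖ ^ 2 / (4 * t)) (‖x‖ ^ 2 / (4 * t ^ 2)) t := by
    have := ((hasDerivAt_const t (-‖x‖ ^ 2)).div ((hasDerivAt_id t).const_mul 4)
      (by simpa using ht.ne'))
    refine this.congr_deriv ?_
    simp
    field_simp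
  have h := (h1.rpow_const (p := -(N : ℝ) / 2) (Or.inl (by positivity))).mul h2.exp
  refine h.congr_deriv ?_
  rw [heatKernel, Real.rpow_sub_one (by positivity)]
  field_simp
  ring

lemma fderiv_heatKernelExt_time {N : ℕ} {q : EuclideanSpace ℝ (Fin N) × ℝ} (hq : q ≠ 0) :
    fderiv ℝ (heatKernelExt N) q (0, 1) =
      ∑ i, fderiv ℝ (fun p => fderiv ℝ (heatKernelExt N) p (EuclideanSpace.single i 1, 0)) q
        (EuclideanSpace.single i 1, 0) := by
  simp_rw [← iteratedDeriv_two_comp_line (contDiffAt_heatKernelExt 2 hq)]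
  rcases le_or_gt q.2 0 with h | h
  · have hmin : IsLocalMin (heatKernelExt N) q := Eventually.of_forall fun p => by
      rw [heatKernelExt_of_nonpos h]
      exact heatKernelExt_nonneg p
    have hzero : ∀ i : Fin N, (fun r : ℝ => heatKernelExt N
        (q + r • ((EuclideanSpace.single i 1 : EuclideanSpace ℝ (Fin N)), (0 : ℝ)))) =
        fun _ => 0 :=
      fun i => funext fun r => heatKernelExt_of_nonpos (by simpa using h)
    rw [hmin.fderiv_eq_zero]
    simp_rw [hzero]
    simp
  · have hline : HasDerivAt (fun t : ℝ => (q.1, t)) ((0 : EuclideanSpace ℝ (Fin N)), (1 : ℝ)) q.2 :=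
      (hasDerivAt_const q.2 q.1).prodMk (hasDerivAt_id q.2)
    have hcomp := ((contDiffAt_heatKernelExt 1 hq).differentiableAt
      (by simp)).hasFDerivAt.comp_hasDerivAt q.2 hline
    have heq : heatKernelExt N ∘ (fun t : ℝ => (q.1, t)) =ᶠ[𝓝 q.2] heatKernel N q.1 := by
      filter_upwards [Ioi_mem_nhds h] with t ht using heatKernelExt_of_pos ht
    rw [hcomp.unique ((hasDerivAt_heatKernel q.1 h).congr_of_eventuallyEq heq)]
    have hspace : ∀ i : Fin N, (fun r : ℝ => heatKernelExt N
        (q + r • ((EuclideanSpace.single i 1 : EuclideanSpace ℝ (Fin N)), (0 : ℝ)))) =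
        fun r => (4 * π * q.2) ^ (-(N : ℝ) / 2) *
          Real.exp (-(‖q.1‖ ^ 2 + 2 * q.1 i * r + r ^ 2) / (4 * q.2)) := by
      intro i
      funext r
      rw [heatKernelExt_of_pos (by simpa using h), heatKernel]
      simp [norm_add_sq_real, norm_smul, inner_smul_right, EuclideanSpace.inner_single_right]
      left
      ring_nf
    simp_rw [hspace, iteratedDeriv_two_exp_neg_sq _ _ _ _ h.ne', ← Finset.mul_sum,
      Finset.sum_sub_distrib, ← Finset.sum_div, EuclideanSpace.real_norm_sq_eq]
    simp [heatKernel, EuclideanSpace.real_norm_sq_eq]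

lemma Fsol_eq_integral_heatKernelExt {N : ℕ} (hN : N ≠ 0) {ξ : ℝ → EuclideanSpace ℝ (Fin N)}
    (hξ : Continuous ξ) {T : ℝ} {p : EuclideanSpace ℝ (Fin N) × ℝ} (hp : p.2 ∈ Ioo 0 T)
    (hne : p.1 ≠ ξ p.2) :
    Fsol N ξ p.1 p.2 = ∫ s in (0 : ℝ)..T, heatKernelExt N (p - (ξ s, s)) := by
  have hcont : Continuous fun s => heatKernelExt N (p - (ξ s, s)) := by
    refine continuous_iff_continuousAt.2 fun s => ?_
    have h0 : p - (ξ s, s) ≠ 0 := fun h => by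
      have := sub_eq_zero.1 h
      exact hne (by rw [this])
    exact (contDiffAt_heatKernelExt 0 h0).continuousAt.comp (f := fun s => p - (ξ s, s))
      (by fun_prop)
  rw [← intervalIntegral.integral_add_adjacent_intervals (b := p.2)
    (hcont.intervalIntegrable _ _) (hcont.intervalIntegrable _ _)]
  have h2 : ∫ s in p.2..T, heatKernelExt N (p - (ξ s, s)) = 0 := by
    rw [intervalIntegral.integral_congr (g := fun _ => 0), intervalIntegral.integral_zero]
    intro s hs
    rw [uIcc_of_le hp.2.le] at hs
    exact heatKernelExt_of_nonpos (sub_nonpos.2 hs.1)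
  rw [h2, add_zero, Fsol]
  refine intervalIntegral.integral_congr fun s hs => ?_
  rw [uIcc_of_le hp.1.le] at hs
  rcases hs.2.eq_or_lt with rfl | h
  · have hN' : -(N : ℝ) / 2 ≠ 0 := by simpa using hN
    simp [heatKernel, heatKernelExt, Real.zero_rpow hN']
  · exact (heatKernelExt_of_pos (q := p - (ξ s, s)) (sub_pos.2 h)).symm

/-- Proposition 4.1: F is a classical solution of the heat equation away
from the moving point x = ξ(t). -/
theorem Fsol_isHeatSolution {N : ℕ} (hN : 2 ≤ N) (T : ℝ) (hT : 0 < T)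
    (ξ : ℝ → EuclideanSpace ℝ (Fin N)) (hξ : Continuous ξ) :
    IsHeatSolution (Fsol N ξ) {p | p.2 ∈ Ioo (0 : ℝ) T ∧ p.1 ≠ ξ p.2} := by
  set D : Set (EuclideanSpace ℝ (Fin N) × ℝ) := {p | p.2 ∈ Ioo (0 : ℝ) T ∧ p.1 ≠ ξ p.2}
  set γ : ℝ → EuclideanSpace ℝ (Fin N) × ℝ := fun s => (ξ s, s)
  have hγ : Continuous γ := by fun_prop
  have hDopen : IsOpen D := (isOpen_Ioo.preimage continuous_snd).inter
    (isOpen_ne_fun continuous_fst (hξ.comp continuous_snd))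
  set U : EuclideanSpace ℝ (Fin N) × ℝ → ℝ :=
    fun p => ∫ s in (0 : ℝ)..T, heatKernelExt N (p - γ s)
  set S := γ '' uIcc 0 T
  have hSopen : IsOpen Sᶜ := (isCompact_uIcc.image hγ).isClosed.isOpen_compl
  have hDS : ∀ p ∈ D, p ∈ Sᶜ := by
    rintro p hp ⟨s, -, rfl⟩
    exact hp.2 rfl
  have hFU : ∀ p ∈ D, Fsol N ξ p.1 p.2 = U p := fun p hp =>
    Fsol_eq_integral_heatKernelExt (by omega) hξ hp.1 hp.2
  have hk : ∀ n : ℕ, ContDiffOn ℝ n (heatKernelExt N) {0}ᶜ := contDiffOn_heatKernelExt N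
  have hU : ContDiffOn ℝ 2 U Sᶜ := contDiffOn_intervalIntegral_comp_sub 2 (hk 3) hγ 0 T
  have hfderiv : ∀ {k : EuclideanSpace ℝ (Fin N) × ℝ → ℝ}, ContDiffOn ℝ 1 k {0}ᶜ → ∀ p ∈ Sᶜ, ∀ v,
      fderiv ℝ (fun q => ∫ s in (0 : ℝ)..T, k (q - γ s)) p v =
        ∫ s in (0 : ℝ)..T, fderiv ℝ k (p - γ s) v := by
    intro k hk p hp v
    rw [(hasFDerivAt_intervalIntegral_comp_sub hk hγ hp).fderiv]
    refine ContinuousLinearMap.intervalIntegral_apply (ContinuousOn.intervalIntegrable ?_) v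
    exact (hk.continuousOn_fderiv_of_isOpen isOpen_compl_singleton le_rfl).comp (by fun_prop)
      fun s hs h => hp ⟨s, hs, (sub_eq_zero.1 h).symm⟩
  have hdir : ∀ v, ContDiffOn ℝ 1 (fun q => fderiv ℝ (heatKernelExt N) q v) {0}ᶜ := fun v =>
    ((hk 2).fderiv_of_isOpen isOpen_compl_singleton (by norm_num)).clm_apply contDiffOn_const
  refine ⟨(hU.continuousOn.mono hDS).congr hFU, fun p hp => ?_⟩
  have hpγ : ∀ s, p - γ s ≠ 0 := fun s h => by
    rw [sub_eq_zero] at h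
    exact hp.2 (by rw [h])
  have hUp : ContDiffAt ℝ 2 U p := hU.contDiffAt (hSopen.mem_nhds (hDS p hp))
  have hDp : ∀ᶠ q in 𝓝 p, q ∈ D := hDopen.mem_nhds hp
  have hx : Tendsto (fun x => (x, p.2)) (𝓝 p.1) (𝓝 p) :=
    (Continuous.prodMk_left p.2).tendsto p.1
  have ht : Tendsto (fun t => (p.1, t)) (𝓝 p.2) (𝓝 p) :=
    (Continuous.prodMk_right p.1).tendsto p.2
  constructor
  · refine ContDiffAt.congr_of_eventuallyEq (f := U ∘ fun x => (x, p.2)) ?_ ?_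
    · exact ContDiffAt.comp p.1 hUp (contDiffAt_id.prodMk contDiffAt_const)
    · filter_upwards [hx.eventually hDp] with x hx using hFU _ hx
  · have htime : HasDerivAt (fun τ => Fsol N ξ p.1 τ) (fderiv ℝ U p (0, 1)) p.2 := by
      have hline : HasDerivAt (fun t : ℝ => (p.1, t))
          ((0 : EuclideanSpace ℝ (Fin N)), (1 : ℝ)) p.2 :=
        (hasDerivAt_const p.2 p.1).prodMk (hasDerivAt_id p.2)
      refine ((hUp.differentiableAt two_ne_zero).hasFDerivAt.comp_hasDerivAt p.2
        hline).congr_of_eventuallyEq ?_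
      filter_upwards [ht.eventually hDp] with t ht using hFU _ ht
    refine htime.congr_deriv ?_
    have hspace : ∀ i : Fin N, iteratedDeriv 2
        (fun h : ℝ => Fsol N ξ (p.1 + h • EuclideanSpace.single i (1 : ℝ)) p.2) 0 =
        ∫ s in (0 : ℝ)..T, fderiv ℝ (fun q => fderiv ℝ (heatKernelExt N) q
          (EuclideanSpace.single i 1, 0)) (p - γ s) (EuclideanSpace.single i 1, 0) := by
      intro i
      set v : EuclideanSpace ℝ (Fin N) × ℝ := (EuclideanSpace.single i 1, 0)
      have hv : Tendsto (fun h : ℝ => p + h • v) (𝓝 0) (𝓝 p) := by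
        have : Continuous fun h : ℝ => p + h • v := by fun_prop
        simpa using this.tendsto 0
      have heq : (fun h : ℝ => Fsol N ξ (p.1 + h • EuclideanSpace.single i (1 : ℝ)) p.2)
          =ᶠ[𝓝 0] fun h => U (p + h • v) := by
        filter_upwards [hv.eventually hDp] with h hh
        simpa [v] using hFU _ hh
      rw [heq.iteratedDeriv_eq, iteratedDeriv_two_comp_line hUp]
      have hev : (fun q => fderiv ℝ U q v) =ᶠ[𝓝 p]
          fun q => ∫ s in (0 : ℝ)..T, fderiv ℝ (heatKernelExt N) (q - γ s) v := by
        filter_upwards [hSopen.mem_nhds (hDS p hp)] with q hq using hfderiv (hk 1) q hq v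
      rw [hev.fderiv_eq]
      exact hfderiv (hdir v) p (hDS p hp) v
    simp_rw [hspace]
    rw [← intervalIntegral.integral_finsetSum, hfderiv (hk 1) p (hDS p hp)]
    · exact intervalIntegral.integral_congr fun s _ =>
        fderiv_heatKernelExt_time (hpγ s)
    · refine fun i _ => Continuous.intervalIntegrable ?_ _ _
      have hcont := ((hdir (EuclideanSpace.single i 1, 0)).continuousOn_fderiv_of_isOpen
        isOpen_compl_singleton le_rfl).comp_continuous (continuous_const.sub hγ) hpγ
      exact hcont.clm_apply continuous_const
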